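/- (Koebe's disk theorem) There exists a constant b ∈ (1, ∞) such that for every injective holomorphic function f : D₁ → ℂ with f(0) = 0 and f'(0) = 1, the image Ω = f(D₁) satisfies 1/b ≤ dist(0, ℂ \ Ω) ≤ 1, where dist(0, ℂ \ Ω) = inf{|w| : w ∈ ℂ \ Ω}. -/

import Mathlib

open Metric Set Filter Topology

/-- An injective function on an open set is not locally constant there. -/
lemma not_eventually_const_of_injOn {f : ℂ → ℂ} {U : Set ℂ} (hU : IsOpen U)
    (hinj : InjOn f U) {a : ℂ} (ha : a ∈ U) : ¬ ∀ᶠ z in 𝓝 a, f z = f a := by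
  intro h
  have h1 : ∀ᶠ z in 𝓝[≠] a, z = a :=
    eventually_nhdsWithin_of_eventually_nhds
      ((h.and (hU.mem_nhds ha)).mono fun z hz => hinj hz.2 ha hz.1)
  have h2 : ∀ᶠ z in 𝓝[≠] a, z ≠ a := self_mem_nhdsWithin
  obtain ⟨z, hz, hz'⟩ := (h1.and h2).exists
  exact hz' hz

/-- The derivative of an injective holomorphic function has at most isolated zeros. -/
lemma eventually_deriv_ne_zero_of_injOn {f : ℂ → ℂ} {U : Set ℂ} (hU : IsOpen U)
    (hf : DifferentiableOn ℂ f U) (hinj : InjOn f U) {a : ℂ} (ha : a ∈ U) :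
    ∀ᶠ z in 𝓝[≠] a, deriv f z ≠ 0 := by
  have hfa : AnalyticAt ℂ f a := hf.analyticAt (hU.mem_nhds ha)
  refine hfa.deriv.eventually_eq_zero_or_eventually_ne_zero.resolve_left fun h => ?_
  obtain ⟨r, hr, hball⟩ := Metric.eventually_nhds_iff_ball.1 (h.and (hU.mem_nhds ha))
  refine not_eventually_const_of_injOn hU hinj ha ?_
  filter_upwards [ball_mem_nhds a hr] with z hz
  exact isOpen_ball.is_const_of_deriv_eq_zero (convex_ball a r).isPreconnected
    (hf.mono fun y hy => (hball y hy).2) (fun y hy => (hball y hy).1) hz (mem_ball_self hr)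

/-- The inverse of an injective holomorphic function is holomorphic. -/
lemma differentiableAt_invFunOn {f : ℂ → ℂ} {U : Set ℂ} (hU : IsOpen U)
    (hf : DifferentiableOn ℂ f U) (hinj : InjOn f U) {a : ℂ} (ha : a ∈ U) :
    DifferentiableAt ℂ (Function.invFunOn f U) (f a) := by
  set g := Function.invFunOn f U
  have hgf : ∀ z ∈ U, g (f z) = z := fun z hz => hinj.leftInvOn_invFunOn hz
  have hopen : ∀ z ∈ U, 𝓝 (f z) ≤ map f (𝓝 z) := fun z hz =>
    (hf.analyticAt (hU.mem_nhds hz)).eventually_constant_or_nhds_le_map_nhds.resolve_left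
      (not_eventually_const_of_injOn hU hinj hz)
  have himage : ∀ z ∈ U, ∀ s ∈ 𝓝 z, f '' s ∈ 𝓝 (f z) := fun z hz s hs =>
    hopen z hz (image_mem_map hs)
  have hcont : ∀ z ∈ U, ContinuousAt g (f z) := by
    intro z hz s hs
    rw [hgf z hz] at hs
    rw [Filter.mem_map]
    filter_upwards [himage z hz _ (inter_mem hs (hU.mem_nhds hz))]
    rintro _ ⟨y, ⟨hys, hyU⟩, rfl⟩
    simpa [hgf y hyU] using hys
  have hdiff : ∀ z ∈ U, deriv f z ≠ 0 → DifferentiableAt ℂ g (f z) := by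
    intro z hz hz'
    refine (HasDerivAt.of_local_left_inverse (f := f) (f' := deriv f z) (hcont z hz) ?_ hz'
      ?_).differentiableAt
    · rw [hgf z hz]
      exact (hf.differentiableAt (hU.mem_nhds hz)).hasDerivAt
    · filter_upwards [himage z hz U (hU.mem_nhds hz)]
      rintro _ ⟨y, hy, rfl⟩
      rw [hgf y hy]
  refine (Complex.analyticAt_of_differentiable_on_punctured_nhds_of_continuousAt ?_
    (hcont a ha)).differentiableAt
  have h := himage a ha _ (inter_mem (eventually_nhdsWithin_iff.1
    (eventually_deriv_ne_zero_of_injOn hU hf hinj ha)) (hU.mem_nhds ha))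
  filter_upwards [mem_nhdsWithin_of_mem_nhds h, self_mem_nhdsWithin]
  rintro _ ⟨y, ⟨hy, hyU⟩, rfl⟩ hne
  exact hdiff y hyU (hy fun hya => hne (by rw [mem_singleton_iff.1 hya]; rfl))

/-- A disk about `0` covered by a normalized injective holomorphic function on the unit disk
has radius at most one. -/
lemma radius_le_one_of_ball_subset_image {f : ℂ → ℂ} {r : ℝ}
    (hf : DifferentiableOn ℂ f (ball 0 1)) (hinj : InjOn f (ball 0 1))
    (h0 : f 0 = 0) (h1 : deriv f 0 = 1) (hr : ball 0 r ⊆ f '' ball 0 1) : r ≤ 1 := by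
  by_contra! hr1
  have hr0 : 0 < r := by linarith
  set g := Function.invFunOn f (ball (0 : ℂ) 1)
  have hgf : ∀ z ∈ ball (0 : ℂ) 1, g (f z) = z := fun z hz => hinj.leftInvOn_invFunOn hz
  have h00 : (0 : ℂ) ∈ ball (0 : ℂ) 1 := mem_ball_self one_pos
  have hg0 : g 0 = 0 := by simpa [h0] using hgf 0 h00
  have hg : DifferentiableOn ℂ g (ball 0 r) := by
    intro w hw
    obtain ⟨z, hz, rfl⟩ := hr hw
    exact (differentiableAt_invFunOn isOpen_ball hf hinj hz).differentiableWithinAt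
  have hmaps : MapsTo g (ball 0 r) (closedBall (g 0) 1) := by
    intro w hw
    obtain ⟨z, hz, rfl⟩ := hr hw
    rw [hg0, hgf z hz]
    exact ball_subset_closedBall hz
  have hle := Complex.norm_deriv_le_div_of_mapsTo_ball hg hmaps hr0
  have hf' : HasDerivAt f 1 0 := by
    rw [← h1]; exact (hf.differentiableAt (ball_mem_nhds 0 one_pos)).hasDerivAt
  have hg' : HasDerivAt g (deriv g 0) (f 0) := by
    rw [h0]; exact (hg.differentiableAt (ball_mem_nhds 0 hr0)).hasDerivAt
  have hcomp := hg'.comp 0 hf'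
  have hid : HasDerivAt (g ∘ f) 1 0 :=
    (hasDerivAt_id (0 : ℂ)).congr_of_eventuallyEq
      (eventually_of_mem (isOpen_ball.mem_nhds h00) fun z hz => hgf z hz)
  have hone : deriv g 0 = 1 := by simpa using hcomp.unique hid
  rw [hone, norm_one, le_div_iff₀ hr0] at hle
  linarith

/-- A zero-free holomorphic function on a disk has a holomorphic square root. -/
lemma exists_differentiableOn_sq_eq {h : ℂ → ℂ} {c : ℂ} {r : ℝ} (hr : 0 < r)
    (hh : DifferentiableOn ℂ h (ball c r)) (hne : ∀ z ∈ ball c r, h z ≠ 0) :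
    ∃ g : ℂ → ℂ, DifferentiableOn ℂ g (ball c r) ∧ ∀ z, g z ^ 2 = h z := by
  have : ContractibleSpace (ball c r) := (convex_ball c r).contractibleSpace (nonempty_ball.2 hr)
  have hsc : IsSimplyConnected (ball c r) := SimplyConnectedSpace.ofContractible _
  obtain ⟨g, hgc, hg⟩ := Complex.exists_continuousOn_pow_eq hsc isOpen_ball hh.continuousOn
    (by rintro ⟨z, hz, h0⟩; exact hne z hz h0) two_ne_zero
  refine ⟨g, fun z hz => ?_, hg⟩
  have hnhds := isOpen_ball.mem_nhds hz
  have hgz : g z ≠ 0 := fun h0 => hne z hz (by simp [← hg, h0])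
  exact (HasDerivAt.of_comp_left (f := (· ^ 2)) (hgc.continuousAt hnhds)
    (by simpa using hasDerivAt_pow 2 (g z)) (hh.differentiableAt hnhds).hasDerivAt
    (by simpa using hgz) (.of_forall hg)).differentiableAt.differentiableWithinAt

/-- If `g` is holomorphic on the unit disk and stays at distance at least `1 / 2` from `-g 0`,
where `‖g 0‖ = 1`, then its derivative at `0` is at most `20`. -/
lemma norm_deriv_le_of_half_le_norm_add {g : ℂ → ℂ} (hg : DifferentiableOn ℂ g (ball 0 1))
    (hg0 : ‖g 0‖ = 1) (hfar : ∀ z ∈ ball (0 : ℂ) 1, 1 / 2 ≤ ‖g z + g 0‖) :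
    ‖deriv g 0‖ ≤ 20 := by
  have h00 : (0 : ℂ) ∈ ball (0 : ℂ) 1 := mem_ball_self one_pos
  have hne : ∀ z ∈ ball (0 : ℂ) 1, g z + g 0 ≠ 0 := fun z hz h => by
    have := hfar z hz
    rw [h, norm_zero] at this
    linarith
  have hbound : ∀ z ∈ ball (0 : ℂ) 1, ‖(g z + g 0)⁻¹‖ ≤ 2 := fun z hz => by
    rw [norm_inv]
    exact inv_le_of_inv_le₀ (by norm_num) (by simpa using hfar z hz)
  have hle := Complex.norm_deriv_le_div_of_mapsTo_ball (R₂ := 4)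
    (f := fun z => (g z + g 0)⁻¹) ((hg.add_const _).inv hne)
    (fun z hz => by
      rw [mem_closedBall, dist_eq_norm]
      linarith [norm_sub_le (g z + g 0)⁻¹ (g 0 + g 0)⁻¹, hbound z hz, hbound 0 h00]) one_pos
  have hder := (((hg.differentiableAt (ball_mem_nhds 0 one_pos)).hasDerivAt.add_const
    (g 0)).fun_inv (hne 0 h00)).deriv
  rw [hder, norm_div, norm_neg, norm_pow, ← two_mul, norm_mul, hg0] at hle
  norm_num at hle
  linarith

/-- A normalized injective holomorphic function on the unit disk which is bounded by `2 ^ n / 2`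
omits no value of norm less than `1 / 100`. -/
lemma le_norm_of_bounded (n : ℕ) : ∀ f : ℂ → ℂ, DifferentiableOn ℂ f (ball 0 1) →
    InjOn f (ball 0 1) → f 0 = 0 → deriv f 0 = 1 →
    (∀ z ∈ ball (0 : ℂ) 1, ‖f z‖ ≤ 2 ^ n / 2) →
    ∀ w ∉ f '' ball 0 1, 1 / 100 ≤ ‖w‖ := by
  have h00 : (0 : ℂ) ∈ ball (0 : ℂ) 1 := mem_ball_self one_pos
  induction n with
  | zero =>
    intro f hf _ h0 h1 hB
    have := Complex.norm_deriv_le_div_of_mapsTo_ball hf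
      (fun z hz => by simpa [h0] using hB z hz) one_pos
    rw [h1] at this
    norm_num at this
  | succ n ih =>
    intro f hf hinj h0 h1 hB w hw
    by_contra! hlt
    have hw0 : w ≠ 0 := fun h => hw ⟨0, h00, by rw [h0, h]⟩
    have hd : 0 < ‖w‖ := norm_pos_iff.2 hw0
    obtain ⟨g, hg, hsq⟩ := exists_differentiableOn_sq_eq (h := fun z => 1 - f z / w) one_pos
      ((hf.div_const w).const_sub 1) (fun z hz h => hw ⟨z, hz, by
        field_simp at h
        linear_combination -h⟩)
    have hval : ∀ z, f z = w * (1 - g z ^ 2) := fun z => by rw [hsq]; field_simp; ring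
    have hg0sq : g 0 ^ 2 = 1 := by simp [hsq, h0]
    have hg0 : ‖g 0‖ = 1 := by
      have : ‖g 0‖ ^ 2 = 1 := by rw [← norm_pow, hg0sq, norm_one]
      nlinarith [norm_nonneg (g 0)]
    have hgd := (hg.differentiableAt (ball_mem_nhds 0 one_pos)).hasDerivAt
    have hmul : 2 * g 0 * deriv g 0 * w = -1 := by
      have h2 : HasDerivAt f (w * -(2 * g 0 * deriv g 0)) 0 := by
        rw [funext hval]
        simpa using ((hgd.pow 2).const_sub 1).const_mul w
      rw [h2.deriv] at h1
      linear_combination -h1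
    have hM : 2 * ‖deriv g 0‖ * ‖w‖ = 1 := by
      have := congrArg norm hmul
      simpa [hg0] using this
    set m := deriv g 0 with hm
    have hm0 : m ≠ 0 := fun h => by simp [h] at hM
    have hMpos : 0 < ‖m‖ := norm_pos_iff.2 hm0
    have hMlarge : 50 < ‖m‖ := by nlinarith
    have hginj : InjOn g (ball 0 1) := fun x hx y hy hxy =>
      hinj hx hy (by rw [hval, hval, hxy])
    have hgneg : ∀ x ∈ ball (0 : ℂ) 1, ∀ y ∈ ball (0 : ℂ) 1, g x ≠ -g y := by
      intro x hx y hy hxy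
      obtain rfl : x = y := hinj hx hy (by rw [hval, hval, hxy, neg_sq])
      have : g x = 0 := by linear_combination hxy / 2
      exact hw ⟨x, hx, by simp [hval x, this]⟩
    -- the growth bound for `g`
    set B : ℝ := 2 ^ (n + 1) / 2 with hBdef
    have hB1 : 1 ≤ B := by
      have : (1 : ℝ) ≤ 2 ^ n := one_le_pow₀ (by norm_num)
      rw [hBdef, pow_succ]; linarith
    have hgB : ∀ z ∈ ball (0 : ℂ) 1, ‖g z‖ ≤ B / (8 * ‖w‖) := by
      intro z hz
      have h3 : ‖g z‖ ^ 2 ≤ 1 + B / ‖w‖ := by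
        rw [← norm_pow, hsq]
        refine (norm_sub_le _ _).trans ?_
        rw [norm_one, norm_div]
        gcongr
        exact hB z hz
      have h4 : 100 ≤ B / ‖w‖ := by rw [le_div_iff₀ hd]; linarith
      have h5 : B / (8 * ‖w‖) = B / ‖w‖ / 8 := by field_simp
      rw [h5]
      refine abs_le_of_sq_le_sq' ?_ (by linarith) |>.2
      nlinarith
    have hG : ball (0 : ℂ) (1 / 100) ⊆ (fun z => (g z - g 0) / m) '' ball 0 1 := by
      intro v hv
      by_contra hv'
      refine absurd (ih (fun z => (g z - g 0) / m) ((hg.sub_const _).div_const m) ?_ (by simp) ?_ ?_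
        v hv') (by simpa using hv)
      · intro x hx y hy hxy
        refine hginj hx hy ?_
        have := (div_left_inj' hm0).1 hxy
        linear_combination this
      · simpa [hm0] using ((hgd.sub_const (g 0)).div_const m).deriv
      · intro z hz
        rw [norm_div, div_le_iff₀ hMpos]
        refine (norm_sub_le _ _).trans ?_
        have h6 := hgB z hz
        have h7 : B / (8 * ‖w‖) = B * ‖m‖ / 4 := by
          rw [div_eq_div_iff (by positivity) (by norm_num)]
          linear_combination (-4 * B) * hM
        have h8 : (2 : ℝ) ^ n / 2 = B / 2 := by rw [hBdef, pow_succ]; ring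
        rw [h8, hg0]
        nlinarith
    refine absurd (norm_deriv_le_of_half_le_norm_add hg hg0 fun z hz => ?_) (by linarith)
    by_contra! hnear
    obtain ⟨y, hy, hyv⟩ := hG (show (-g z - g 0) / m ∈ ball (0 : ℂ) (1 / 100) by
      rw [mem_ball_zero_iff, norm_div, div_lt_iff₀ hMpos, ← neg_add', norm_neg]
      linarith)
    have := (div_left_inj' hm0).1 hyv
    exact hgneg y hy z hz (by linear_combination this)

/-- A normalized injective holomorphic function on the unit disk omits no value of norm less than
`1 / 100`. -/
lemma le_norm_of_notMem_image {f : ℂ → ℂ} (hf : DifferentiableOn ℂ f (ball 0 1))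
    (hinj : InjOn f (ball 0 1)) (h0 : f 0 = 0) (h1 : deriv f 0 = 1) {w : ℂ}
    (hw : w ∉ f '' ball 0 1) : 1 / 100 ≤ ‖w‖ := by
  by_contra! hlt
  obtain ⟨r, hr, hr1⟩ := exists_between (show max (1 / 2) (100 * ‖w‖) < 1 by
    rw [max_lt_iff]; constructor <;> linarith)
  obtain ⟨hr2, hrw⟩ := max_lt_iff.1 hr
  have hrpos : 0 < r := by linarith
  have hrc : (r : ℂ) ≠ 0 := by exact_mod_cast hrpos.ne'
  have hmaps : MapsTo (fun z : ℂ => r * z) (ball 0 1) (closedBall 0 r) := fun z hz => by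
    rw [mem_ball_zero_iff] at hz
    simp only [mem_closedBall, dist_zero_right, norm_mul, Complex.norm_real, Real.norm_eq_abs,
      abs_of_pos hrpos]
    nlinarith
  have hsub : closedBall (0 : ℂ) r ⊆ ball 0 1 := closedBall_subset_ball hr1
  obtain ⟨C, hC⟩ := (isCompact_closedBall (0 : ℂ) r).exists_bound_of_continuousOn
    (hf.continuousOn.mono hsub)
  obtain ⟨n, hn⟩ := pow_unbounded_of_one_lt (2 * (C / r)) (one_lt_two : (1 : ℝ) < 2)
  have hfd : HasDerivAt f 1 ((r : ℂ) * 0) := by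
    rw [mul_zero, ← h1]
    exact (hf.differentiableAt (ball_mem_nhds 0 one_pos)).hasDerivAt
  have hle := le_norm_of_bounded n (fun z => f (r * z) / r)
    ((hf.comp (by fun_prop) (hmaps.mono_right hsub)).div_const _)
    (fun x hx y hy hxy => mul_left_cancel₀ hrc
      (hinj (hsub (hmaps hx)) (hsub (hmaps hy)) ((div_left_inj' hrc).1 hxy)))
    (by simp [h0])
    (by
      have hd := (hfd.comp 0 ((hasDerivAt_id (0 : ℂ)).const_mul (r : ℂ))).div_const (r : ℂ)
      simpa [hrc, Function.comp_def] using hd.deriv)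
    (fun z hz => by
      rw [norm_div, Complex.norm_real, Real.norm_eq_abs, abs_of_pos hrpos]
      have : ‖f (r * z)‖ / r ≤ C / r := by
        gcongr
        exact hC _ (hmaps hz)
      linarith)
    (w / r) (fun ⟨z, hz, hzw⟩ => hw ⟨r * z, hsub (hmaps hz), (div_left_inj' hrc).1 hzw⟩)
  rw [norm_div, Complex.norm_real, Real.norm_eq_abs, abs_of_pos hrpos, le_div_iff₀ hrpos] at hle
  linarith

/-- **Koebe's disk theorem.** There is a constant `b ∈ (1, ∞)` such that for every
injective holomorphic `f` on the unit disk with `f 0 = 0` and `f' 0 = 1`, the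
distance from `0` to the complement of the image `Ω = f(D₁)` lies in `[1/b, 1]`. -/
theorem koebe_disk_theorem :
    ∃ b : ℝ, 1 < b ∧ ∀ f : ℂ → ℂ,
      DifferentiableOn ℂ f (Metric.ball 0 1) → Set.InjOn f (Metric.ball 0 1) →
      f 0 = 0 → deriv f 0 = 1 →
      1 / b ≤ Metric.infDist 0 ((f '' Metric.ball 0 1)ᶜ) ∧
        Metric.infDist 0 ((f '' Metric.ball 0 1)ᶜ) ≤ 1 := by
  refine ⟨100, by norm_num, fun f hf hinj h0 h1 => ⟨?_, ?_⟩⟩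
  · have hne : ((f '' ball 0 1)ᶜ).Nonempty := by
      by_contra hempty
      rw [not_nonempty_iff_eq_empty, compl_empty_iff] at hempty
      have := radius_le_one_of_ball_subset_image (r := 2) hf hinj h0 h1
        (hempty ▸ subset_univ _)
      norm_num at this
    refine (le_infDist hne).2 fun w hw => ?_
    rw [dist_zero_left]
    exact le_norm_of_notMem_image hf hinj h0 h1 hw
  · refine radius_le_one_of_ball_subset_image hf hinj h0 h1 ?_
    simpa using ball_infDist_subset_compl (x := (0 : ℂ)) (s := (f '' ball 0 1)ᶜ)
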